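/- (Lipschitz bound for the variance of increments of the limiting kernel.) Under the kernel assumptions, for every m > 0 there exists a constant C > 0 such that for all t_1 ≤ t in [−m, m], V(t,t) + V(t_1,t_1) − 2V(t,t_1) ≤ C·(t − t_1). (This quantity equals the variance E(𝓜(t) − 𝓜(t_1))² of the increment of any centered Gaussian process 𝓜 with covariance V.) -/

import Mathlib

open MeasureTheory ProbabilityTheory Matrix Filter Set
open scoped Topology ENNReal NNReal BigOperators

noncomputable section

/-- `H(x) = E[ε · 1_{ε ≤ x}]` for `ε ∼ μ`. -/
def Hfun (μ : Measure ℝ) (x : ℝ) : ℝ := ∫ t in Iic x, t ∂μ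

/-- The limiting covariance kernel `V(x,z)` of the paper. -/
def Vker {p : ℕ} (F : ℝ → ℝ) (μ : Measure ℝ) (σ : ℝ) (A : Matrix (Fin p) (Fin p) ℝ)
    (b xf : Fin p → ℝ) (x z : ℝ) : ℝ :=
  σ ^ 2 * deriv F x * deriv F z * (xf ⬝ᵥ (A⁻¹ *ᵥ xf) + 1 - 2 * (xf ⬝ᵥ (A⁻¹ *ᵥ b)))
    - (deriv F x * Hfun μ z + deriv F z * Hfun μ x) * (xf ⬝ᵥ (A⁻¹ *ᵥ b) - 1)
    + F (min x z) - F x * F z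

/-- `U(x) = V(x,x) + V(−x,−x) − 2·V(x,−x)`. -/
def Uker {p : ℕ} (F : ℝ → ℝ) (μ : Measure ℝ) (σ : ℝ) (A : Matrix (Fin p) (Fin p) ℝ)
    (b xf : Fin p → ℝ) (x : ℝ) : ℝ :=
  Vker F μ σ A b xf x x + Vker F μ σ A b xf (-x) (-x) - 2 * Vker F μ σ A b xf x (-x)

/-- standard normal CDF `Φ`. -/
def stdNormCDF (y : ℝ) : ℝ := ((gaussianReal 0 1) (Iic y)).toReal

/-- OLS estimator `(XᵀX)⁻¹Xᵀ y`. -/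
def olsBeta {p n : ℕ} (X : Matrix (Fin n) (Fin p) ℝ) (yv : Fin n → ℝ) : Fin p → ℝ :=
  (Xᵀ * X)⁻¹ *ᵥ (Xᵀ *ᵥ yv)

/-- raw estimated residuals `ε̂'_i = y_i − x_iᵀβ̂`. -/
def rawResid {p n : ℕ} (X : Matrix (Fin n) (Fin p) ℝ) (yv : Fin n → ℝ) (i : Fin n) : ℝ :=
  yv i - X i ⬝ᵥ olsBeta X yv

/-- centered estimated residuals `ε̂_i`. -/
def ctrResid {p n : ℕ} (X : Matrix (Fin n) (Fin p) ℝ) (yv : Fin n → ℝ) (i : Fin n) : ℝ :=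
  rawResid X yv i - (n : ℝ)⁻¹ * ∑ j, rawResid X yv j

/-- empirical CDF of the finite data vector `e`. -/
def empCDF {n : ℕ} (e : Fin n → ℝ) (x : ℝ) : ℝ :=
  (n : ℝ)⁻¹ * ∑ i, if e i ≤ x then (1 : ℝ) else 0

/-- empirical measure of the finite data vector `e`. -/
def empMeas {n : ℕ} (e : Fin n → ℝ) : Measure ℝ :=
  ((n : ℝ≥0∞))⁻¹ • ∑ i, Measure.dirac (e i)

/-- `x_fᵀ (XᵀX)⁻¹ Xᵀ z`. -/
def linComb {p n : ℕ} (X : Matrix (Fin n) (Fin p) ℝ) (xf : Fin p → ℝ) (z : Fin n → ℝ) : ℝ :=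
  xf ⬝ᵥ ((Xᵀ * X)⁻¹ *ᵥ (Xᵀ *ᵥ z))

/-- Bootstrap coverage function
`G*_n(x) = ∫∫ 1_{|u − x_fᵀ(XᵀX)⁻¹Xᵀz| ≤ x} dF̂^{⊗n}(z) dF̂(u)`. -/
def bootCov {p n : ℕ} (X : Matrix (Fin n) (Fin p) ℝ) (xf : Fin p → ℝ) (e : Fin n → ℝ)
    (x : ℝ) : ℝ :=
  ∫ z : Fin n → ℝ, (∫ u : ℝ, (if |u - linComb X xf z| ≤ x then (1 : ℝ) else 0) ∂(empMeas e))
    ∂(Measure.pi fun _ : Fin n => empMeas e)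

/-- the vector of centered OLS residuals computed from the linear model `y = Xβ + ε(ω)`. -/
def residVec {Ω : Type} {p n : ℕ} (X : Matrix (Fin n) (Fin p) ℝ) (β : Fin p → ℝ)
    (ε : ℕ → Ω → ℝ) (ω : Ω) : Fin n → ℝ :=
  ctrResid X fun i => X i ⬝ᵥ β + ε i.val ω

/-- `w_n(ω) = x_fᵀ(XᵀX)⁻¹Xᵀ ε(ω)`. -/
def wRand {Ω : Type} {p n : ℕ} (X : Matrix (Fin n) (Fin p) ℝ) (xf : Fin p → ℝ)
    (ε : ℕ → Ω → ℝ) (ω : Ω) : ℝ :=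
  linComb X xf fun i => ε i.val ω

/-- bootstrap quantile `c*_{n,τ} = inf{x : G*_n(x) ≥ τ}`. -/
def bootQuantile {p n : ℕ} (X : Matrix (Fin n) (Fin p) ℝ) (xf : Fin p → ℝ) (e : Fin n → ℝ)
    (τ : ℝ) : ℝ :=
  sInf {x : ℝ | τ ≤ bootCov X xf e x}

/-- `Λ(z) = x_fᵀ(XᵀX)⁻¹Xᵀz − (1/n)∑ z_i`. -/
def lamComb {p n : ℕ} (X : Matrix (Fin n) (Fin p) ℝ) (xf : Fin p → ℝ) (z : Fin n → ℝ) : ℝ :=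
  linComb X xf z - (n : ℝ)⁻¹ * ∑ i, z i

/-- the bootstrap process `M̂(x) = √n (F̂(x + Λ(e*)) − (1/n)∑ 1_{e*_i ≤ x})`,
as a function of the bootstrap sample `e*`; `ehat` is the residual vector from which `F̂` is built. -/
def mHatB {p n : ℕ} (X : Matrix (Fin n) (Fin p) ℝ) (xf : Fin p → ℝ) (ehat estar : Fin n → ℝ)
    (x : ℝ) : ℝ :=
  Real.sqrt (n : ℝ) * (empCDF ehat (x + lamComb X xf estar) - empCDF estar x)

/-- `Ŝ(x) = M̂(x) − M̂⁻(−x)` where `M̂⁻` is the left limit. -/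
def sHatB {p n : ℕ} (X : Matrix (Fin n) (Fin p) ℝ) (xf : Fin p → ℝ) (ehat estar : Fin n → ℝ)
    (x : ℝ) : ℝ :=
  mHatB X xf ehat estar x - Function.leftLim (fun u => mHatB X xf ehat estar u) (-x)

/-- the bootstrap product measure `F̂^{⊗n}` on `ℝⁿ`. -/
def bootPi {n : ℕ} (ehat : Fin n → ℝ) : Measure (Fin n → ℝ) :=
  Measure.pi fun _ : Fin n => empMeas ehat

/-- `d*_{1−γ}(x) = inf{z : P*(−Ŝ(x) ≤ z) ≥ 1−γ}`. -/
def dStar {p n : ℕ} (X : Matrix (Fin n) (Fin p) ℝ) (xf : Fin p → ℝ) (ehat : Fin n → ℝ)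
    (γ x : ℝ) : ℝ :=
  sInf {z : ℝ | 1 - γ ≤ ((bootPi ehat) {estar | -(sHatB X xf ehat estar x) ≤ z}).toReal}

/-- `c*(1−α, 1−γ) = c*_{n, 1−α + d*_{1−γ}(c*_{n,1−α})/√n}`. -/
def cFinal {p n : ℕ} (X : Matrix (Fin n) (Fin p) ℝ) (xf : Fin p → ℝ) (ehat : Fin n → ℝ)
    (α γ : ℝ) : ℝ :=
  bootQuantile X xf ehat
    (1 - α + dStar X xf ehat γ (bootQuantile X xf ehat (1 - α)) / Real.sqrt (n : ℝ))

theorem Vker_increment {p : ℕ} (F : ℝ → ℝ) (μ : Measure ℝ) (σ : ℝ)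
    (A : Matrix (Fin p) (Fin p) ℝ) (b xf : Fin p → ℝ) {s t : ℝ} (hst : s ≤ t) :
    Vker F μ σ A b xf t t + Vker F μ σ A b xf s s - 2 * Vker F μ σ A b xf t s =
      σ ^ 2 * (xf ⬝ᵥ (A⁻¹ *ᵥ xf) + 1 - 2 * (xf ⬝ᵥ (A⁻¹ *ᵥ b))) * (deriv F t - deriv F s) ^ 2
        - 2 * (xf ⬝ᵥ (A⁻¹ *ᵥ b) - 1) * (Hfun μ t - Hfun μ s) * (deriv F t - deriv F s)
        + (F t - F s) - (F t - F s) ^ 2 := by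
  simp only [Vker, min_self, min_eq_right hst]
  ring

theorem abs_Hfun_le {μ : Measure ℝ} (h : Integrable (fun x : ℝ => x) μ) (x : ℝ) :
    |Hfun μ x| ≤ ∫ t, |t| ∂μ :=
  (abs_integral_le_integral_abs).trans
    (setIntegral_le_integral h.abs (ae_of_all _ fun _ => abs_nonneg _))

theorem integrable_id_of_integrable_pow_four {μ : Measure ℝ} [IsFiniteMeasure μ]
    (h : Integrable (fun x : ℝ => x ^ 4) μ) : Integrable (fun x : ℝ => x) μ := by
  refine (h.add (integrable_const (1 : ℝ))).mono' aestronglyMeasurable_id (ae_of_all _ fun x => ?_)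
  simp only [Pi.add_apply, Real.norm_eq_abs]
  rw [abs_le]
  constructor <;> nlinarith [sq_nonneg (x ^ 2 - 1 / 2), sq_nonneg (x - 1 / 2), sq_nonneg (x + 1 / 2)]

theorem abs_sub_le_of_abs_deriv_le {f : ℝ → ℝ} (hf : Differentiable ℝ f) {K a c : ℝ}
    (hK : ∀ x ∈ Icc a c, |deriv f x| ≤ K) {s t : ℝ} (hs : s ∈ Icc a c) (ht : t ∈ Icc a c)
    (hst : s ≤ t) : |f t - f s| ≤ K * (t - s) := by
  have h := (convex_Icc a c).norm_image_sub_le_of_norm_deriv_le (fun x _ => hf x) hK hs ht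
  rwa [Real.norm_eq_abs, Real.norm_eq_abs, abs_of_nonneg (sub_nonneg.2 hst)] at h

/-- Lipschitz bound for the variance of increments of the limiting
kernel: on `[−m, m]`, `V(t,t) + V(t₁,t₁) − 2V(t,t₁) ≤ C (t − t₁)`. -/
theorem kernel_increment_variance_lipschitz
    (p : ℕ)
    -- the law `μ` of the error `ε₁` is absolutely continuous, with CDF `F`
    (μ : Measure ℝ) [IsProbabilityMeasure μ] (habs : μ ≪ volume)
    (F : ℝ → ℝ) (hFdef : ∀ x, F x = (μ (Iic x)).toReal)
    (hFsmooth : ContDiff ℝ 2 F)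
    (hF''bdd : ∃ C : ℝ, ∀ x, |deriv (deriv F) x| ≤ C)
    (hF'pos : ∀ x, 0 < deriv F x)
    (σ : ℝ) (hmean : ∫ x, x ∂μ = 0) (hvar : ∫ x, x ^ 2 ∂μ = σ ^ 2)
    (hmom4 : Integrable (fun x : ℝ => x ^ 4) μ)
    (A : Matrix (Fin p) (Fin p) ℝ) (hA : IsUnit A.det)
    (b xf : Fin p → ℝ)
    : ∀ m : ℝ, 0 < m → ∃ C > (0:ℝ), ∀ t₁ t : ℝ,
      t₁ ∈ Icc (-m) m → t ∈ Icc (-m) m → t₁ ≤ t →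
      Vker F μ σ A b xf t t + Vker F μ σ A b xf t₁ t₁ - 2 * Vker F μ σ A b xf t t₁
        ≤ C * (t - t₁) := by
  intro m hm
  obtain ⟨K, hK⟩ := hF''bdd
  have hK0 : 0 ≤ K := (abs_nonneg _).trans (hK 0)
  have hF'smooth : ContDiff ℝ 1 (deriv F) := by
    have h : ContDiff ℝ (1 + 1) F := by simpa [one_add_one_eq_two] using hFsmooth
    exact (contDiff_succ_iff_deriv.1 h).2.2
  have hFdiff : Differentiable ℝ F := hFsmooth.differentiable (by norm_num)
  obtain ⟨M, hM⟩ := isCompact_Icc.exists_bound_of_continuousOn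
    (s := Icc (-m) m) hF'smooth.continuous.continuousOn
  have hM0 : 0 ≤ M := (norm_nonneg _).trans (hM 0 ⟨by linarith, hm.le⟩)
  have hint := integrable_id_of_integrable_pow_four hmom4
  set B := ∫ t, |t| ∂μ
  have hB0 : 0 ≤ B := integral_nonneg fun _ => abs_nonneg _
  set c := σ ^ 2 * (xf ⬝ᵥ (A⁻¹ *ᵥ xf) + 1 - 2 * (xf ⬝ᵥ (A⁻¹ *ᵥ b))) with hc
  set l := xf ⬝ᵥ (A⁻¹ *ᵥ b) - 1 with hl
  refine ⟨|c| * (K ^ 2 * (2 * m)) + 2 * |l| * (2 * B) * K + M + 1, by positivity, ?_⟩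
  intro s t hs ht hst
  rw [Vker_increment F μ σ A b xf hst, ← hc, ← hl]
  have hδ : 0 ≤ t - s := sub_nonneg.2 hst
  have hδm : t - s ≤ 2 * m := by linarith [hs.1, ht.2]
  have hF' : |deriv F t - deriv F s| ≤ K * (t - s) :=
    abs_sub_le_of_abs_deriv_le (hF'smooth.differentiable one_ne_zero) (fun x _ => hK x) hs ht hst
  have hF : F t - F s ≤ M * (t - s) :=
    (le_abs_self _).trans (abs_sub_le_of_abs_deriv_le hFdiff hM hs ht hst)
  have hH : |Hfun μ t - Hfun μ s| ≤ 2 * B := by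
    linarith [abs_sub (Hfun μ t) (Hfun μ s), abs_Hfun_le hint t, abs_Hfun_le hint s]
  have hquad : c * (deriv F t - deriv F s) ^ 2 ≤ |c| * (K ^ 2 * (2 * m)) * (t - s) := by
    calc c * (deriv F t - deriv F s) ^ 2 ≤ |c| * |deriv F t - deriv F s| ^ 2 := by
          rw [sq_abs]; gcongr; exact le_abs_self c
      _ ≤ |c| * (K * (t - s)) ^ 2 := by gcongr
      _ = |c| * (K ^ 2 * (t - s)) * (t - s) := by ring
      _ ≤ |c| * (K ^ 2 * (2 * m)) * (t - s) := by gcongr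
  have hcross : -(2 * l * (Hfun μ t - Hfun μ s) * (deriv F t - deriv F s))
      ≤ 2 * |l| * (2 * B) * K * (t - s) := by
    calc -(2 * l * (Hfun μ t - Hfun μ s) * (deriv F t - deriv F s))
        ≤ |2 * l * (Hfun μ t - Hfun μ s) * (deriv F t - deriv F s)| := neg_le_abs _
      _ = 2 * |l| * |Hfun μ t - Hfun μ s| * |deriv F t - deriv F s| := by
          simp only [abs_mul, abs_two]
      _ ≤ 2 * |l| * (2 * B) * (K * (t - s)) := by gcongr
      _ = 2 * |l| * (2 * B) * K * (t - s) := by ring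
  linarith [sq_nonneg (F t - F s)]
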